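/- An element c of a pseudo-effect algebra E is central if and only if the following three conditions hold: (i) for every a ∈ E there are a₁, a₂ ∈ E with a₁ ≤ c, a₂ ≤ c∼ and a = a₁ + a₂; (ii) if a,b ≤ c (respectively a,b ≤ c∼) and a+b is defined, then a+b ≤ c (respectively a+b ≤ c∼); (iii) if x,y ∈ E with x ≤ c and y ≤ c∼, then x+y = y+x. -/

import Mathlib

namespace PEApaper

/-- The bare data of a partial-addition structure: a partial binary operation
(encoded via `Option`) together with constants `0` and `1`. -/
structure PartialStruct (E : Type) where
  padd : E → E → Option E
  zero : E
  one : E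

namespace PartialStruct

variable {E : Type}

/-- `a ≤ b` iff `a + c = b` for some `c`. -/
def le (P : PartialStruct E) (a b : E) : Prop := ∃ c, P.padd a c = some b

/-- `m` is the greatest lower bound (meet `a ∧ b`) of `a` and `b`. -/
def IsMeet (P : PartialStruct E) (a b m : E) : Prop :=
  P.le m a ∧ P.le m b ∧ ∀ x, P.le x a → P.le x b → P.le x m

/-- `j` is the least upper bound (join `a ∨ b`) of `a` and `b`. -/
def IsJoin (P : PartialStruct E) (a b j : E) : Prop :=
  P.le a j ∧ P.le b j ∧ ∀ x, P.le a x → P.le b x → P.le j x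

/-- `s` is the supremum of the set `S`. -/
def IsSup (P : PartialStruct E) (S : Set E) (s : E) : Prop :=
  (∀ x ∈ S, P.le x s) ∧ ∀ u, (∀ x ∈ S, P.le x u) → P.le s u

/-- Left-associated partial sum of a list, continuing from `acc`. -/
def IsSumFrom (P : PartialStruct E) : E → List E → E → Prop
  | acc, [], s => s = acc
  | acc, a :: l, s => ∃ t, P.padd acc a = some t ∧ IsSumFrom P t l s

/-- `s` is the (left-associated) orthosum `e₁ + e₂ + ⋯ + eₙ` of the list. -/
def IsSumList (P : PartialStruct E) (l : List E) (s : E) : Prop :=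
  match l with
  | [] => s = P.zero
  | a :: t => IsSumFrom P a t s

/-- `c` is a central element: there is a PEA-isomorphism
`f : E → E[0,c] × E[0,c∼]` with `f c = (c,0)` such that `f x = (x₁,x₂)`
implies `x = x₁ + x₂`.  The isomorphism onto the product of the two
interval pseudo-effect algebras is spelled out explicitly. -/
def IsCentral (P : PartialStruct E) (c : E) : Prop :=
  ∃ cs, P.padd c cs = some P.one ∧
    ∃ f : E → E × E,
      (∀ x, P.le (f x).1 c ∧ P.le (f x).2 cs) ∧
      Function.Injective f ∧
      (∀ y : E × E, P.le y.1 c → P.le y.2 cs → ∃ x, f x = y) ∧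
      f c = (c, P.zero) ∧
      f P.one = (c, cs) ∧
      (∀ x, P.padd (f x).1 (f x).2 = some x) ∧
      (∀ a b ab, P.padd a b = some ab →
        P.padd (f a).1 (f b).1 = some (f ab).1 ∧
        P.padd (f a).2 (f b).2 = some (f ab).2) ∧
      (∀ a b s t, P.padd (f a).1 (f b).1 = some s → P.le s c →
        P.padd (f a).2 (f b).2 = some t → P.le t cs →
        ∃ ab, P.padd a b = some ab)

/-- The center `Γ(E)`. -/
def center (P : PartialStruct E) : Set E := {c | P.IsCentral c}

/-- The central interval `Γ(E)[0,c] = Γ(E) ∩ E[0,c]`. -/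
def centerIntervalSet (P : PartialStruct E) (c : E) : Set E :=
  {x | P.IsCentral x ∧ P.le x c}

/-- A Γ-orthogonal family: one dominated elementwise by a pairwise
disjoint family of central elements. -/
def GammaOrthogonal (P : PartialStruct E) {I : Type} (e : I → E) : Prop :=
  ∃ c : I → E, (∀ i, P.IsCentral (c i)) ∧
    (∀ i j, i ≠ j → P.IsMeet (c i) (c j) P.zero) ∧
    ∀ i, P.le (e i) (c i)

/-- Centrally orthocomplete: every Γ-orthogonal family has a supremum. -/
def IsCOPEA (P : PartialStruct E) : Prop :=
  ∀ (I : Type) (e : I → E), P.GammaOrthogonal e → ∃ s, P.IsSup (Set.range e) s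

/-- `c` is the central cover of `e`: the smallest central element above `e`. -/
def IsCentralCover (P : PartialStruct E) (c e : E) : Prop :=
  P.IsCentral c ∧ P.le e c ∧ ∀ d, P.IsCentral d → P.le e d → P.le c d

/-- `[Q]`: the set of all suprema of Γ-orthogonal families of elements of `Q`. -/
def bra (P : PartialStruct E) (Q : Set E) : Set E :=
  {s | ∃ (I : Type) (e : I → E), (∀ i, e i ∈ Q) ∧ P.GammaOrthogonal e ∧
    P.IsSup (Set.range e) s}

/-- `Q^γ = {q ∧ c : q ∈ Q, c ∈ Γ(E)}`. -/
def gammaClosure (P : PartialStruct E) (Q : Set E) : Set E :=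
  {m | ∃ q ∈ Q, ∃ c, P.IsCentral c ∧ P.IsMeet q c m}

/-- `Q↓ = ⋃_{q ∈ Q} E[0,q]`. -/
def downSet (P : PartialStruct E) (Q : Set E) : Set E :=
  {e | ∃ q ∈ Q, P.le e q}

/-- `Q' = {e ∈ E : q ∧ e = 0 for all q ∈ Q}`. -/
def commutant (P : PartialStruct E) (Q : Set E) : Set E :=
  {e | ∀ q ∈ Q, P.IsMeet q e P.zero}

/-- A type-determining (TD) set: `K = [K] = K^γ`. -/
def IsTD (P : PartialStruct E) (K : Set E) : Prop :=
  P.bra K = K ∧ P.gammaClosure K = K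

/-- A strongly type-determining (STD) set: `K = [K] = K↓`. -/
def IsSTD (P : PartialStruct E) (K : Set E) : Prop :=
  P.bra K = K ∧ P.downSet K = K

/-- `c` is the type-cover of `K` (w.r.t. the central cover map `γ`):
the unique central element with `γK = Γ(E)[0,c]`. -/
def IsTypeCover (P : PartialStruct E) (γ : E → E) (K : Set E) (c : E) : Prop :=
  P.IsCentral c ∧ γ '' K = P.centerIntervalSet c

/-- An atom: a nonzero element with no proper nonzero subelement. -/
def IsAtom' (P : PartialStruct E) (a : E) : Prop :=
  a ≠ P.zero ∧ ∀ x, P.le x a → x = P.zero ∨ x = a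

end PartialStruct

/-- A PEA-isomorphism between two partial-addition structures: a bijective
morphism whose inverse is a morphism. -/
structure IsPEAIso {A B : Type} (P : PartialStruct A) (Q : PartialStruct B)
    (f : A → B) : Prop where
  bijective : Function.Bijective f
  map_one : f P.one = Q.one
  map_add : ∀ a b ab, P.padd a b = some ab → Q.padd (f a) (f b) = some (f ab)
  rev_add : ∀ a b s, Q.padd (f a) (f b) = some s → ∃ ab, P.padd a b = some ab

open scoped Classical in
/-- The (coordinatewise) product of a family of partial structures. -/
noncomputable def prodStruct {I : Type} {A : I → Type}
    (Ps : ∀ i, PartialStruct (A i)) : PartialStruct (∀ i, A i) where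
  padd a b :=
    if h : ∀ i, ∃ s, (Ps i).padd (a i) (b i) = some s
    then some fun i => Classical.choose (h i)
    else none
  zero := fun i => (Ps i).zero
  one := fun i => (Ps i).one

/-- A pseudo-effect algebra. -/
structure PEA (E : Type) extends PartialStruct E where
  assoc_def : ∀ a b c : E,
    (∃ ab, padd a b = some ab ∧ ∃ x, padd ab c = some x) ↔
    (∃ bc, padd b c = some bc ∧ ∃ y, padd a bc = some y)
  assoc_eq : ∀ a b c ab bc x y, padd a b = some ab → padd ab c = some x →
    padd b c = some bc → padd a bc = some y → x = y
  exu_right : ∀ a : E, ∃! d, padd a d = some one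
  exu_left : ∀ a : E, ∃! e, padd e a = some one
  shift : ∀ a b ab, padd a b = some ab →
    (∃ d, padd d a = some ab) ∧ (∃ e, padd b e = some ab)
  one_add : ∀ a x, padd one a = some x → a = zero
  add_one : ∀ a x, padd a one = some x → a = zero

namespace PEA

variable {E : Type} (P : PEA E)

/-- Shorthand for the underlying partial structure. -/
abbrev ps : PartialStruct E := P.toPartialStruct

theorem one_add_zero : P.padd P.one P.zero = some P.one := by
  obtain ⟨d, hd, -⟩ := P.exu_right P.one
  have h := P.one_add d P.one hd
  rwa [h] at hd

theorem zero_add_one : P.padd P.zero P.one = some P.one := by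
  obtain ⟨e, he, -⟩ := P.exu_left P.one
  have h := P.add_one e P.one he
  rwa [h] at he

theorem padd_zero (a : E) : P.padd a P.zero = some a := by
  obtain ⟨e, he, -⟩ := P.exu_left a
  have h1 : ∃ ab, P.padd e a = some ab ∧ ∃ x, P.padd ab P.zero = some x :=
    ⟨P.one, he, P.one, P.one_add_zero⟩
  obtain ⟨t, ht, y, hy⟩ := (P.assoc_def e a P.zero).mp h1
  have hxy : P.one = y :=
    P.assoc_eq e a P.zero P.one t P.one y he P.one_add_zero ht hy
  obtain ⟨d, hd, hu⟩ := P.exu_right e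
  have hta : t = a := by
    have h2 : t = d := hu t (by rw [← hxy] at hy; exact hy)
    have h3 : a = d := hu a he
    rw [h2, h3]
  rwa [hta] at ht

theorem zero_padd (a : E) : P.padd P.zero a = some a := by
  obtain ⟨d, hd, -⟩ := P.exu_right a
  have h1 : ∃ bc, P.padd a d = some bc ∧ ∃ y, P.padd P.zero bc = some y :=
    ⟨P.one, hd, P.one, P.zero_add_one⟩
  obtain ⟨t, ht, y, hy⟩ := (P.assoc_def P.zero a d).mpr h1
  have hxy : y = P.one :=
    P.assoc_eq P.zero a d t P.one y P.one ht hy hd P.zero_add_one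
  obtain ⟨e, he, hu⟩ := P.exu_left d
  have hta : t = a := by
    have h2 : t = e := hu t (by rw [hxy] at hy; exact hy)
    have h3 : a = e := hu a hd
    rw [h2, h3]
  rwa [hta] at ht

theorem zero_le (a : E) : P.ps.le P.zero a := ⟨a, P.zero_padd a⟩

theorem le_refl (a : E) : P.ps.le a a := ⟨P.zero, P.padd_zero a⟩

open scoped Classical in
/-- The interval pseudo-effect algebra `E[0,p]` as a partial structure on
the subtype `{x // x ≤ p}`; the sum is defined iff it is defined in `E`
and lies below `p`, and the unit is `p`. -/
noncomputable def intervalStruct (p : E) :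
    PartialStruct {x : E // P.ps.le x p} where
  padd a b := (P.padd a.1 b.1).bind fun s =>
    if h : P.ps.le s p then some ⟨s, h⟩ else none
  zero := ⟨P.zero, P.zero_le p⟩
  one := ⟨p, P.le_refl p⟩

end PEA

/-- The order relation of a complete Boolean algebra structure, made explicit. -/
def cbaLe {X : Type} (inst : CompleteBooleanAlgebra X) (a b : X) : Prop :=
  @LE.le X (by letI := inst; exact inferInstance) a b

end PEApaper

namespace PEApaper.PEA

variable {E : Type} (P : PEA E)

theorem assoc_right {a b c ab x : E} (h₁ : P.padd a b = some ab)
    (h₂ : P.padd ab c = some x) :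
    ∃ bc, P.padd b c = some bc ∧ P.padd a bc = some x := by
  obtain ⟨bc, hbc, y, hy⟩ := (P.assoc_def a b c).mp ⟨ab, h₁, x, h₂⟩
  exact ⟨bc, hbc, by rw [P.assoc_eq a b c ab bc x y h₁ h₂ hbc hy, hy]⟩

theorem assoc_left {a b c bc x : E} (h₁ : P.padd b c = some bc)
    (h₂ : P.padd a bc = some x) :
    ∃ ab, P.padd a b = some ab ∧ P.padd ab c = some x := by
  obtain ⟨ab, hab, y, hy⟩ := (P.assoc_def a b c).mpr ⟨bc, h₁, x, h₂⟩
  exact ⟨ab, hab, by rw [← P.assoc_eq a b c ab bc y x hab hy h₁ h₂, hy]⟩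

theorem padd_left_cancel {a b b' s : E} (h : P.padd a b = some s)
    (h' : P.padd a b' = some s) : b = b' := by
  obtain ⟨d, hd, -⟩ := P.exu_right s
  obtain ⟨t, ht, hat⟩ := P.assoc_right h hd
  obtain ⟨t', ht', hat'⟩ := P.assoc_right h' hd
  obtain rfl : t = t' := (P.exu_right a).unique hat hat'
  obtain ⟨u, hu, -⟩ := P.exu_right t
  obtain ⟨v, hv, hbv⟩ := P.assoc_right ht hu
  obtain ⟨v', hv', hbv'⟩ := P.assoc_right ht' hu
  obtain rfl : v = v' := Option.some.inj (hv.symm.trans hv')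
  exact (P.exu_left v).unique hbv hbv'

theorem eq_zero_of_padd_eq_self {a b : E} (h : P.padd a b = some a) : b = P.zero :=
  P.padd_left_cancel h (P.padd_zero a)

theorem right_eq_zero_of_padd_eq_zero {a b : E} (h : P.padd a b = some P.zero) :
    b = P.zero := by
  obtain ⟨t, ht, -⟩ := P.assoc_right h P.zero_add_one
  exact P.add_one b t ht

theorem left_eq_zero_of_padd_eq_zero {a b : E} (h : P.padd a b = some P.zero) :
    a = P.zero := by
  have hb := P.right_eq_zero_of_padd_eq_zero h
  rw [hb, P.padd_zero] at h
  exact Option.some.inj h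

theorem le_antisymm {a b : E} (hab : P.ps.le a b) (hba : P.ps.le b a) : a = b := by
  obtain ⟨x, hx⟩ := hab
  obtain ⟨y, hy⟩ := hba
  obtain ⟨t, ht, hat⟩ := P.assoc_right hx hy
  obtain rfl := P.eq_zero_of_padd_eq_self hat
  rw [P.left_eq_zero_of_padd_eq_zero ht, P.padd_zero] at hx
  exact Option.some.inj hx

theorem le_of_padd_le_padd_left {a b b' s s' : E} (h : P.padd a b = some s)
    (h' : P.padd a b' = some s') (hs : P.ps.le s s') : P.ps.le b b' := by
  obtain ⟨w, hw⟩ := hs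
  obtain ⟨t, ht, hat⟩ := P.assoc_right h hw
  exact ⟨w, by rw [ht, P.padd_left_cancel hat h']⟩

theorem exists_padd_of_le_right {a b b' s : E} (h : P.padd a b' = some s)
    (hb : P.ps.le b b') : ∃ t, P.padd a b = some t := by
  obtain ⟨r, hr⟩ := hb
  obtain ⟨t, ht, -⟩ := P.assoc_left hr h
  exact ⟨t, ht⟩

theorem exists_padd_eq_of_le {a b : E} (h : P.ps.le a b) : ∃ d, P.padd d a = some b := by
  obtain ⟨r, hr⟩ := h
  exact (P.shift a r b hr).1

theorem exists_padd_of_le_left {a a' b s : E} (h : P.padd a' b = some s)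
    (ha : P.ps.le a a') : ∃ t, P.padd a b = some t := by
  obtain ⟨d, hd⟩ := P.exists_padd_eq_of_le ha
  obtain ⟨t, ht, -⟩ := P.assoc_right hd h
  exact ⟨t, ht⟩

theorem exists_padd_of_le_of_le {a a' b b' s : E} (h : P.padd a' b' = some s)
    (ha : P.ps.le a a') (hb : P.ps.le b b') : ∃ t, P.padd a b = some t := by
  obtain ⟨t, ht⟩ := P.exists_padd_of_le_right h hb
  exact P.exists_padd_of_le_left ht ha

/-- If two middle summands commute, they may be exchanged in a sum of two sums. -/
theorem padd_padd_comm {a b c d ab cd bc s : E} (hab : P.padd a b = some ab)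
    (hcd : P.padd c d = some cd) (h : P.padd ab cd = some s)
    (hbc : P.padd b c = some bc) (hcb : P.padd c b = some bc) :
    ∃ ac bd, P.padd a c = some ac ∧ P.padd b d = some bd ∧ P.padd ac bd = some s := by
  obtain ⟨u, hu, hus⟩ := P.assoc_right hab h
  obtain ⟨v, hv, hvu⟩ := P.assoc_left hcd hu
  obtain rfl : bc = v := Option.some.inj (hbc.symm.trans hv)
  obtain ⟨bd, hbd, hcu⟩ := P.assoc_right hcb hvu
  obtain ⟨ac, hac, hs⟩ := P.assoc_left hcu hus
  exact ⟨ac, bd, hac, hbd, hs⟩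

/-- Decompositions along complementary elements are unique if the first one is closed
under existing sums. -/
theorem decomposition_unique {c cs : E} (hcs : P.padd c cs = some P.one)
    (hc : ∀ a b x, P.ps.le a c → P.ps.le b c → P.padd a b = some x → P.ps.le x c)
    {a₁ a₂ b₁ b₂ a : E} (ha₁ : P.ps.le a₁ c) (ha₂ : P.ps.le a₂ cs)
    (hb₁ : P.ps.le b₁ c) (hb₂ : P.ps.le b₂ cs)
    (ha : P.padd a₁ a₂ = some a) (hb : P.padd b₁ b₂ = some a) :
    a₁ = b₁ ∧ a₂ = b₂ := by
  have key : ∀ {x₁ x₂ y₁ y₂ : E}, P.ps.le x₁ c → P.ps.le x₂ cs → P.ps.le y₁ c →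
      P.padd x₁ x₂ = some a → P.padd y₁ y₂ = some a → P.ps.le y₁ x₁ := by
    intro x₁ x₂ y₁ y₂ hx₁ hx₂ hy₁ hx hy
    obtain ⟨d, hd⟩ := P.exists_padd_eq_of_le hx₁
    obtain ⟨s, hs⟩ := P.exists_padd_of_le_right hcs hx₂
    obtain ⟨t, ht, hdt⟩ := P.assoc_right hd hs
    obtain rfl : a = t := Option.some.inj (hx.symm.trans ht)
    obtain ⟨e, he, -⟩ := P.assoc_left hy hdt
    exact P.le_of_padd_le_padd_left he hd (hc d y₁ e ⟨x₁, hd⟩ hy₁ he)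
  obtain rfl : a₁ = b₁ := P.le_antisymm (key hb₁ hb₂ ha₁ hb ha) (key ha₁ ha₂ hb₁ ha hb)
  exact ⟨rfl, P.padd_left_cancel ha hb⟩

end PEApaper.PEA

open PEApaper PEApaper.PartialStruct in
/-- Theorem 3.12 (intrinsic characterization of central elements):
`c` is central iff
(i) every `a` decomposes as `a = a₁ + a₂` with `a₁ ≤ c`, `a₂ ≤ c∼`;
(ii) `E[0,c]` and `E[0,c∼]` are closed under existing sums;
(iii) elements below `c` commute with elements below `c∼`. -/
theorem stmt4 {E : Type} (P : PEA E) (c cs : E)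
    (hcs : P.ps.padd c cs = some P.ps.one) :
    P.ps.IsCentral c ↔
      ((∀ a, ∃ a₁ a₂, P.ps.le a₁ c ∧ P.ps.le a₂ cs ∧
          P.ps.padd a₁ a₂ = some a) ∧
       (∀ a b x, P.ps.le a c → P.ps.le b c →
          P.ps.padd a b = some x → P.ps.le x c) ∧
       (∀ a b x, P.ps.le a cs → P.ps.le b cs →
          P.ps.padd a b = some x → P.ps.le x cs) ∧
       (∀ x y z, P.ps.le x c → P.ps.le y cs →
          P.ps.padd x y = some z → P.ps.padd y x = some z) ∧
       (∀ x y z, P.ps.le x c → P.ps.le y cs →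
          P.ps.padd y x = some z → P.ps.padd x y = some z)) := by
  constructor
  · rintro ⟨cs', hcs', f, hle, -, -, hfc, hf1, hsum, hadd, hrev⟩
    obtain rfl : cs = cs' := (P.exu_right c).unique hcs hcs'
    have hfcs : (f cs).1 = P.zero := by
      have h := (hadd _ _ _ hcs).1
      rw [hfc, hf1] at h
      exact P.eq_zero_of_padd_eq_self h
    have hlec : ∀ {x}, P.ps.le x c → f x = (x, P.zero) := by
      rintro x ⟨r, hr⟩
      have h := (hadd _ _ _ hr).2
      rw [hfc] at h
      have h₂ := P.left_eq_zero_of_padd_eq_zero h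
      have h₁ := hsum x
      rw [h₂, P.padd_zero] at h₁
      exact Prod.ext (Option.some.inj h₁) h₂
    have hlecs : ∀ {x}, P.ps.le x cs → f x = (P.zero, x) := by
      rintro x ⟨r, hr⟩
      have h := (hadd _ _ _ hr).1
      rw [hfcs] at h
      have h₁ := P.left_eq_zero_of_padd_eq_zero h
      have h₂ := hsum x
      rw [h₁, P.zero_padd] at h₂
      exact Prod.ext h₁ (Option.some.inj h₂)
    have hcomm : ∀ x y z, P.ps.le x c → P.ps.le y cs →
        P.ps.padd y x = some z → P.ps.padd x y = some z := by
      intro x y z hx hy hz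
      have h := hadd _ _ _ hz
      rw [hlec hx, hlecs hy] at h
      have h₁ : x = (f z).1 := Option.some.inj ((P.zero_padd x).symm.trans h.1)
      have h₂ : y = (f z).2 := Option.some.inj ((P.padd_zero y).symm.trans h.2)
      rw [h₁, h₂]
      exact hsum z
    refine ⟨fun a => ⟨_, _, (hle a).1, (hle a).2, hsum a⟩, ?_, ?_, ?_, hcomm⟩
    · intro a b x ha hb hx
      have h := (hadd _ _ _ hx).2
      rw [hlec ha, hlec hb] at h
      have h₂ : P.zero = (f x).2 := Option.some.inj ((P.padd_zero _).symm.trans h)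
      have h₁ := hsum x
      rw [← h₂, P.padd_zero] at h₁
      exact Option.some.inj h₁ ▸ (hle x).1
    · intro a b x ha hb hx
      have h := (hadd _ _ _ hx).1
      rw [hlecs ha, hlecs hb] at h
      have h₁ : P.zero = (f x).1 := Option.some.inj ((P.padd_zero _).symm.trans h)
      have h₂ := hsum x
      rw [← h₁, P.zero_padd] at h₂
      exact Option.some.inj h₂ ▸ (hle x).2
    · intro x y z hx hy hz
      obtain ⟨w, hw⟩ := hrev y x x y
        (by rw [hlec hx, hlecs hy]; exact P.zero_padd x) hx
        (by rw [hlec hx, hlecs hy]; exact P.padd_zero y) hy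
      rw [hw, ← hcomm x y w hx hy hw, hz]
  · rintro ⟨hdec, hc, hcs', hcomm, -⟩
    choose p q hp hq hpq using hdec
    have huniq : ∀ {a x y}, P.ps.le x c → P.ps.le y cs → P.ps.padd x y = some a →
        p a = x ∧ q a = y := fun hx hy h =>
      P.decomposition_unique hcs hc (hp _) (hq _) hx hy (hpq _) h
    have hexists : ∀ {x y}, P.ps.le x c → P.ps.le y cs → ∃ a, P.ps.padd x y = some a :=
      fun hx hy => P.exists_padd_of_le_of_le hcs hx hy
    refine ⟨cs, hcs, fun a => (p a, q a), fun a => ⟨hp a, hq a⟩, ?_, ?_, ?_, ?_, hpq, ?_, ?_⟩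
    · intro a b h
      obtain ⟨h₁, h₂⟩ := Prod.mk.inj h
      have h := hpq a
      rw [h₁, h₂, hpq b] at h
      exact (Option.some.inj h).symm
    · rintro ⟨x, y⟩ hx hy
      obtain ⟨a, ha⟩ := hexists hx hy
      obtain ⟨h₁, h₂⟩ := huniq hx hy ha
      exact ⟨a, Prod.ext h₁ h₂⟩
    · obtain ⟨h₁, h₂⟩ := huniq (P.le_refl c) (P.zero_le cs) (P.padd_zero c)
      exact Prod.ext h₁ h₂
    · obtain ⟨h₁, h₂⟩ := huniq (P.le_refl c) (P.le_refl cs) hcs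
      exact Prod.ext h₁ h₂
    · intro a b ab hab
      obtain ⟨m, hm⟩ := hexists (hp b) (hq a)
      obtain ⟨s, t, hs, ht, hst⟩ := P.padd_padd_comm (hpq a) (hpq b) hab
        (hcomm _ _ _ (hp b) (hq a) hm) hm
      obtain ⟨h₁, h₂⟩ := huniq (hc _ _ _ (hp a) (hp b) hs) (hcs' _ _ _ (hq a) (hq b) ht) hst
      subst h₁ h₂
      exact ⟨hs, ht⟩
    · intro a b s t hs hsc ht htcs
      obtain ⟨w, hw⟩ := hexists hsc htcs
      obtain ⟨m, hm⟩ := hexists (hp b) (hq a)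
      obtain ⟨a', b', ha', hb', hab⟩ := P.padd_padd_comm hs ht hw hm
        (hcomm _ _ _ (hp b) (hq a) hm)
      obtain rfl : a = a' := Option.some.inj ((hpq a).symm.trans ha')
      obtain rfl : b = b' := Option.some.inj ((hpq b).symm.trans hb')
      exact ⟨w, hab⟩
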